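/- arXiv:1812.03386 — 5 statements merged into one kernel-verified Lean document; each statement's English description precedes it below -/
import Mathlib

section
/- Let F be a field and let r(x), q(x) be polynomials with coefficients in F such that r is nonzero and q(0) ≠ 0. Then for all but finitely many t ∈ F, the polynomials r(tx) and q(x) have no common factor; that is, the set {t ∈ F : r(tx) and q(x) are not coprime in F[x]} is finite. -/
/-- **Speyer's lemma.** Let `r(x)` and `q(x)` be polynomials with coefficients in a field
with `r ≠ 0` and `q(0) ≠ 0`. Then for all but finitely many `t`, the polynomials `r(tx)`
and `q(x)` have no common factor, i.e. the set of `t` for which `r(tx)` and `q(x)` are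
not coprime is finite. -/
theorem speyer_lemma_common_factor {F : Type*} [Field F] (r q : Polynomial F)
    (hr : r ≠ 0) (hq : q.eval 0 ≠ 0) :
    {t : F | ¬ IsCoprime (r.comp (Polynomial.C t * Polynomial.X)) q}.Finite := by
  let K := AlgebraicClosure F
  have hq0 : q ≠ 0 := by
    rintro rfl
    simp at hq
  refine Set.Finite.subset (Set.Finite.preimage (algebraMap F K).injective.injOn
    (Set.Finite.image2 (fun b a : K => b / a)
      (r.rootSet_finite K) (q.rootSet_finite K))) ?_
  intro t ht
  rw [Set.mem_ofPred_eq, Polynomial.isCoprime_iff_aeval_ne_zero_of_isAlgClosed F K] at ht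
  push Not at ht
  obtain ⟨a, hra, hqa⟩ := ht
  have ha : a ≠ 0 := by
    rintro rfl
    rw [← map_zero (algebraMap F K), Polynomial.aeval_algebraMap_apply_eq_algebraMap_eval] at hqa
    exact hq ((algebraMap F K).injective hqa)
  rw [Polynomial.aeval_comp] at hra
  refine ⟨algebraMap F K t * a, ?_, a, ?_, mul_div_cancel_right₀ _ ha⟩
  · rw [Polynomial.mem_rootSet]
    exact ⟨hr, by simpa using hra⟩
  · rw [Polynomial.mem_rootSet]
    exact ⟨hq0, hqa⟩
end

section
/- Let k ⊆ M be a finite simple field extension (i.e. M is finite-dimensional over k and there exists α ∈ M with M = k[α], equivalently the intermediate field generated over k by some single element α is all of M). Let M ⊆ E be a finite separable field extension. Then k ⊆ E is a simple extension: there exists γ ∈ E such that the subfield of E generated by γ over k is all of E. -/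
open Polynomial IntermediateField in
/-- Over an infinite field `F`, if `α` is integral and `β` is separable, then some
`α + c • β` with `c ∈ F` generates a field containing `β`. -/
theorem exists_mem_adjoin_add_smul_of_isSeparable {F E : Type*} [Field F] [Infinite F] [Field E]
    [Algebra F E] {α β : E} (hα : IsIntegral F α) (hβ : IsSeparable F β) :
    ∃ c : F, β ∈ F⟮α + c • β⟯ := by
  let A := AlgebraicClosure E
  obtain ⟨c, hc⟩ := Field.primitive_element_inf_aux_exists_c (algebraMap F A)
    (algebraMap E A α) (algebraMap E A β) (minpoly F α) (minpoly F β)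
  refine ⟨c, ?_⟩
  set γ := α + c • β with hγ
  have hsep : IsSeparable F⟮γ⟯ β := hβ.tower_top F⟮γ⟯
  have hroots : (minpoly F⟮γ⟯ β).rootSet A = {algebraMap E A β} := by
    ext x
    rw [mem_rootSet_of_ne (minpoly.ne_zero hsep.isIntegral), Set.mem_singleton_iff]
    refine ⟨fun hx ↦ ?_, fun hx ↦ by rw [hx, aeval_algebraMap_apply, minpoly.aeval, map_zero]⟩
    have hxg : aeval x (minpoly F β) = 0 := by
      rw [← aeval_map_algebraMap F⟮γ⟯]
      exact aeval_eq_zero_of_dvd_aeval_eq_zero (minpoly.dvd_map_of_isScalarTower F F⟮γ⟯ β) hx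
    have hxf : aeval (algebraMap E A γ - algebraMap F A c * x) (minpoly F α) = 0 := by
      let p : F⟮γ⟯[X] := ((minpoly F α).map (algebraMap F F⟮γ⟯)).comp
        (C (AdjoinSimple.gen F γ) - C (algebraMap F F⟮γ⟯ c) * X)
      have hp {B : Type _} [Field B] [Algebra F B] [Algebra F⟮γ⟯ B] [IsScalarTower F F⟮γ⟯ B]
          (y : B) : aeval y p = aeval (algebraMap F⟮γ⟯ B (AdjoinSimple.gen F γ) -
            algebraMap F B c * y) (minpoly F α) := by
        simp [p, aeval_comp, aeval_map_algebraMap, ← IsScalarTower.algebraMap_apply]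
      have hpβ : aeval β p = 0 := by
        rw [hp, AdjoinSimple.algebraMap_gen, hγ, ← Algebra.smul_def, add_sub_cancel_right,
          minpoly.aeval]
      have hpx := aeval_eq_zero_of_dvd_aeval_eq_zero (minpoly.dvd F⟮γ⟯ β hpβ) hx
      rwa [hp, IsScalarTower.algebraMap_apply F⟮γ⟯ E A, AdjoinSimple.algebraMap_gen] at hpx
    by_contra hne
    refine hc _ ((mem_roots_map (minpoly.ne_zero hα)).mpr hxf) x
      ((mem_roots_map (minpoly.ne_zero hβ.isIntegral)).mpr hxg) ?_
    rw [div_eq_iff (sub_ne_zero.mpr hne), hγ, Algebra.smul_def, map_add, map_mul,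
      ← IsScalarTower.algebraMap_apply]
    ring
  have hdeg : (minpoly F⟮γ⟯ β).natDegree = 1 := by
    rw [← card_rootSet_eq_natDegree (K := A) hsep (IsAlgClosed.splits _),
      ← Nat.card_eq_fintype_card, hroots, Nat.card_unique]
  obtain ⟨y, hy⟩ := minpoly.natDegree_eq_one_iff.mp hdeg
  exact hy ▸ y.2

/-- Some `q`-power of an algebraic element is separable, `q` being the exponential
characteristic. -/
theorem exists_isSeparable_pow_expChar_pow (F : Type*) {E : Type*} [Field F] [Field E]
    [Algebra F E] [Algebra.IsAlgebraic F E] (q : ℕ) [ExpChar F q] (x : E) :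
    ∃ n : ℕ, IsSeparable F (x ^ q ^ n) := by
  have : ExpChar (separableClosure F E) q :=
    expChar_of_injective_algebraMap (algebraMap F _).injective q
  obtain ⟨n, y, hy⟩ := IsPurelyInseparable.pow_mem (separableClosure F E) q x
  exact ⟨n, hy ▸ mem_separableClosure_iff.mp y.2⟩

/-- A finite separable extension of a finite simple field extension is simple:
if `k ⊆ M` is finite and simple (generated by a single element) and `M ⊆ E` is finite
and separable, then `k ⊆ E` is simple. -/
theorem simple_of_separable_of_simple (k M E : Type*) [Field k] [Field M] [Field E]
    [Algebra k M] [Algebra M E] [Algebra k E] [IsScalarTower k M E]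
    [FiniteDimensional k M]
    (hsimple : ∃ α : M, IntermediateField.adjoin k {α} = ⊤)
    [FiniteDimensional M E] [Algebra.IsSeparable M E] :
    ∃ γ : E, IntermediateField.adjoin k {γ} = ⊤ := by
  open IntermediateField in
  have : FiniteDimensional k E := .trans k M E
  rcases finite_or_infinite k with _ | _
  · exact Field.exists_primitive_element_of_finite_bot k E
  obtain ⟨α, hα⟩ := hsimple
  obtain ⟨β, hβ⟩ := Field.exists_primitive_element M E
  let q := ringExpChar k
  have : ExpChar M q := expChar_of_injective_algebraMap (algebraMap k M).injective q
  obtain ⟨n, hn⟩ := exists_isSeparable_pow_expChar_pow k q β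
  rw [adjoin_simple_eq_adjoin_pow_expChar_pow_of_isSeparable' M E β q n] at hβ
  set δ := β ^ q ^ n
  obtain ⟨c, hδ⟩ := exists_mem_adjoin_add_smul_of_isSeparable
    (IsIntegral.of_finite k (algebraMap M E α)) hn
  set γ := algebraMap M E α + c • δ with hγ
  refine ⟨γ, ?_⟩
  have hαγ : algebraMap M E α ∈ k⟮γ⟯ := by
    rw [← add_sub_cancel_right (algebraMap M E α) (c • δ)]
    exact sub_mem (mem_adjoin_simple_self k γ) (k⟮γ⟯.smul_mem hδ)
  have hM (m : M) : algebraMap M E m ∈ k⟮γ⟯ := by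
    have hle : k⟮α⟯ ≤ k⟮γ⟯.comap (IsScalarTower.toAlgHom k M E) :=
      adjoin_simple_le_iff.mpr hαγ
    exact hle (hα ▸ mem_top)
  let K : IntermediateField M E := { k⟮γ⟯ with algebraMap_mem' := hM }
  have hK : M⟮δ⟯ ≤ K := adjoin_simple_le_iff.mpr hδ
  exact eq_top_iff.mpr fun x _ ↦ hK (hβ ▸ mem_top)
end

section
/- Let p be an odd prime, let F be a field of characteristic p, and let t ∈ F with t ≠ 0. Let B be the p×p symmetric matrix over F (rows and columns indexed 1,…,p) with B(1,2) = B(2,1) = t, with B(i,j) = 1 whenever i + j = p + 3 and 3 ≤ i, j ≤ p, and all other entries 0. Then B is congruent to the diagonal p×p matrix D with D(i,i) = 1 for i odd and D(i,i) = −1 for i even. -/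
/-- Congruence by a matrix whose `k`-th column is `e_{a k} + β k • e_{b k}`, entrywise. -/
lemma Matrix.transpose_mul_mul_apply_of_two_term_columns {n R : Type*} [Fintype n]
    [DecidableEq n] [CommRing R] (B : Matrix n n R) (a b : n → n) (β : n → R) (k l : n) :
    ((Matrix.of fun i k : n =>
        (if i = a k then 1 else 0) + β k * (if i = b k then 1 else 0)).transpose * B *
      Matrix.of fun i k : n =>
        (if i = a k then 1 else 0) + β k * (if i = b k then 1 else 0)) k l =
      B (a k) (a l) + β k * B (b k) (a l) + β l * B (a k) (b l) + β k * β l * B (b k) (b l) := by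
  simp [Matrix.mul_apply, add_mul, mul_add, Finset.sum_add_distrib, ite_mul]
  ring

/-- The Gram matrix of the Bézoutian of `(y^p − t, y²)` (the `p×p` symmetric matrix with
`B(1,2) = B(2,1) = t`, `B(i,j) = 1` for `i + j = p + 3` with `3 ≤ i, j ≤ p`, and `0`
otherwise, in 1-based indexing) is congruent to the diagonal matrix with entries `1` in the
odd positions and `−1` in the even positions; i.e. the form is `⟨1⟩ + ((p−1)/2)·h`. -/
theorem bezoutian_saito_congruent_diagonal (p : ℕ) (hp : p.Prime) (hodd : Odd p)
    (F : Type*) [Field F] [CharP F p] (t : F) (ht : t ≠ 0) :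
    ∃ P : Matrix (Fin p) (Fin p) F, IsUnit P.det ∧
      P.transpose *
        (Matrix.of fun i j : Fin p =>
          if (i.val = 0 ∧ j.val = 1) ∨ (i.val = 1 ∧ j.val = 0) then t
          else if i.val + j.val = p + 1 ∧ 2 ≤ i.val ∧ 2 ≤ j.val then (1 : F)
          else 0) * P =
      Matrix.diagonal (fun i : Fin p => if Even i.val then (1 : F) else -1) := by
  obtain ⟨q, hq⟩ := hodd
  have hp2 := hp.two_le
  have h2 : (2 : F) ≠ 0 := Ring.two_ne_zero (by rw [ringChar.eq F p]; omega)
  set B : Matrix (Fin p) (Fin p) F := Matrix.of fun i j : Fin p =>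
    if (i.val = 0 ∧ j.val = 1) ∨ (i.val = 1 ∧ j.val = 0) then t
    else if i.val + j.val = p + 1 ∧ 2 ≤ i.val ∧ 2 ≤ j.val then (1 : F) else 0 with hB
  -- Columns `2r, 2r + 1` diagonalize the `r`-th hyperbolic plane; the last column is the vector
  -- fixed by the reflection `i ↦ p + 1 - i`.
  let a : Fin p → Fin p := fun k => ⟨if k.val < 2 then 0 else k.val / 2 + 1, by split_ifs <;> omega⟩
  let b : Fin p → Fin p := fun k => ⟨if k.val < 2 then 1 else p - k.val / 2, by split_ifs <;> omega⟩
  let β : Fin p → F := fun k => if k.val + 1 = p then 0 else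
    (if Even k.val then 1 else -1) * (2 * if k.val < 2 then t else 1)⁻¹
  let P : Matrix (Fin p) (Fin p) F :=
    Matrix.of fun i k => (if i = a k then 1 else 0) + β k * (if i = b k then 1 else 0)
  have haa (k l : Fin p) : B (a k) (a l) = if k = l ∧ k.val + 1 = p then 1 else 0 := by
    simp only [hB, a, Matrix.of_apply, Fin.ext_iff]
    grind
  have hab (k l : Fin p) :
      B (a k) (b l) = if k.val / 2 = l.val / 2 then (if k.val < 2 then t else 1) else 0 := by
    simp only [hB, a, b, Matrix.of_apply]
    grind
  have hba (k l : Fin p) :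
      B (b k) (a l) = if k.val / 2 = l.val / 2 then (if k.val < 2 then t else 1) else 0 := by
    simp only [hB, a, b, Matrix.of_apply]
    grind
  have hbb (k l : Fin p) : B (b k) (b l) = if k = l ∧ k.val + 1 = p then 1 else 0 := by
    simp only [hB, b, Matrix.of_apply, Fin.ext_iff]
    grind
  have hPBP : P.transpose * B * P =
      Matrix.diagonal (fun i : Fin p => if Even i.val then (1 : F) else -1) := by
    ext k l
    rw [Matrix.transpose_mul_mul_apply_of_two_term_columns, haa, hab, hba, hbb,
      Matrix.diagonal_apply]
    by_cases hkl : k = l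
    · subst hkl
      have hc : (if k.val < 2 then t else 1) ≠ 0 := by split_ifs <;> simp [ht]
      by_cases hk : k.val + 1 = p
      · have hk_even : Even k.val := ⟨q, by omega⟩
        simp [β, hk, hk_even]
      · simp only [β, hk, and_false, if_true, if_false]
        field_simp
        ring
    · simp only [hkl, false_and, if_false]
      by_cases hhalf : k.val / 2 = l.val / 2
      · have hsign : (if Even k.val then (1 : F) else -1) = -(if Even l.val then 1 else -1) := by
          simp only [Nat.even_iff]
          split_ifs <;> first | omega | simp
        have hlt : k.val < 2 ↔ l.val < 2 := by omega
        have hβ : β k = -β l := by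
          simp only [β, hlt, hsign, show k.val + 1 ≠ p by omega, show l.val + 1 ≠ p by omega,
            if_false, neg_mul]
        rw [hβ]
        ring
      · simp [hhalf]
  refine ⟨P, ?_, hPBP⟩
  have hdet := congrArg Matrix.det hPBP
  rw [Matrix.det_mul, Matrix.det_diagonal] at hdet
  refine isUnit_iff_ne_zero.mpr (right_ne_zero_of_mul (hdet.trans_ne ?_))
  exact Finset.prod_ne_zero_iff.mpr fun i _ => by split_ifs <;> simp
end

section
/- Let p be an odd prime and let F be a field of characteristic p. Let n = 2p − 2 and let M be the n×n symmetric matrix over F (rows and columns indexed 1,…,n) defined by: M(i,j) = −1 whenever i + j = 2p − 1; M(i,j) = 2 whenever i + j = 3p − 2 with p ≤ i, j ≤ 2p − 2; and all other entries 0. Then M is congruent to the n×n matrix N with N(i,j) = −1 whenever i + j = 2p − 1 and all other entries 0 (the matrix whose only nonzero entries are −1's along the antidiagonal). -/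
/-- A symmetric block matrix `[0, -J; -J, 2J]` is congruent to `[0, -J; -J, 0]` through the
unipotent matrix `[1, 1; 0, 1]`. -/
theorem Matrix.fromBlocks_unipotent_congruence {R n : Type*} [CommRing R] [Fintype n]
    [DecidableEq n] (J : Matrix n n R) :
    (fromBlocks 1 1 0 1 : Matrix (n ⊕ n) (n ⊕ n) R).transpose *
        fromBlocks 0 (-J) (-J) (2 • J) * fromBlocks 1 1 0 1 =
      fromBlocks 0 (-J) (-J) 0 := by
  simp [fromBlocks_transpose, fromBlocks_multiply, two_smul]

/-- The Gram matrix of the Bézoutian of `(−v^{2p−2}, (1 − v^{p−1})²)` (the `(2p−2)×(2p−2)`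
symmetric matrix with `M(i,j) = −1` for `i + j = 2p − 1`, `M(i,j) = 2` for `i + j = 3p − 2`
with `p ≤ i, j ≤ 2p − 2`, and `0` otherwise, in 1-based indexing) is congruent to the matrix
whose only nonzero entries are `−1`'s along the antidiagonal. -/
theorem bezoutian_artin_schreier_congruent_antidiagonal (p : ℕ) (hp : p.Prime) (hodd : Odd p)
    (F : Type*) [Field F] [CharP F p] :
    ∃ P : Matrix (Fin (2 * p - 2)) (Fin (2 * p - 2)) F, IsUnit P.det ∧
      P.transpose *
        (Matrix.of fun i j : Fin (2 * p - 2) =>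
          if i.val + j.val = 2 * p - 3 then (-1 : F)
          else if i.val + j.val = 3 * p - 4 ∧ p - 1 ≤ i.val ∧ p - 1 ≤ j.val then 2
          else 0) * P =
      Matrix.of (fun i j : Fin (2 * p - 2) =>
        if i.val + j.val = 2 * p - 3 then (-1 : F) else 0) := by
  obtain ⟨m, rfl⟩ : ∃ m, p = m + 1 := ⟨p - 1, by have := hp.pos; omega⟩
  let e : Fin m ⊕ Fin m ≃ Fin (2 * (m + 1) - 2) :=
    finSumFinEquiv.trans (finCongr (by omega))
  have val_inl (i : Fin m) : (e (Sum.inl i)).val = i := by simp [e]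
  have val_inr (i : Fin m) : (e (Sum.inr i)).val = m + i := by simp [e, add_comm]
  let J : Matrix (Fin m) (Fin m) F := Matrix.of fun i j => if i.val + j.val + 1 = m then 1 else 0
  let U : Matrix (Fin m ⊕ Fin m) (Fin m ⊕ Fin m) F := Matrix.fromBlocks 1 1 0 1
  refine ⟨U.submatrix e.symm e.symm, ?_, ?_⟩
  · rw [Matrix.det_submatrix_equiv_self, Matrix.det_fromBlocks_zero₂₁]
    simp
  · trans (Matrix.fromBlocks 0 (-J) (-J) 0).submatrix e.symm e.symm
    · rw [← Matrix.fromBlocks_unipotent_congruence, ← Matrix.submatrix_mul_equiv _ _ _ e.symm,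
        ← Matrix.submatrix_mul_equiv _ _ _ e.symm, Matrix.transpose_submatrix]
      congr 2
      ext i j
      obtain ⟨i, rfl⟩ := e.surjective i
      obtain ⟨j, rfl⟩ := e.surjective j
      rcases i with i | i <;> rcases j with j | j <;>
        simp only [Matrix.of_apply, Matrix.submatrix_apply, Equiv.symm_apply_apply, val_inl,
          val_inr, Matrix.fromBlocks_apply₁₁, Matrix.fromBlocks_apply₁₂,
          Matrix.fromBlocks_apply₂₁, Matrix.fromBlocks_apply₂₂, Matrix.zero_apply,
          Matrix.neg_apply, Matrix.smul_apply, J] <;>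
        split_ifs <;> first | omega | simp
    · ext i j
      obtain ⟨i, rfl⟩ := e.surjective i
      obtain ⟨j, rfl⟩ := e.surjective j
      rcases i with i | i <;> rcases j with j | j <;>
        simp only [Matrix.of_apply, Matrix.submatrix_apply, Equiv.symm_apply_apply, val_inl,
          val_inr, Matrix.fromBlocks_apply₁₁, Matrix.fromBlocks_apply₁₂,
          Matrix.fromBlocks_apply₂₁, Matrix.fromBlocks_apply₂₂, Matrix.zero_apply,
          Matrix.neg_apply, J] <;>
        split_ifs <;> first | omega | simp
end

section
/- Let f be a monic polynomial with real coefficients of degree d ≥ 1, regarded as a function f : ℝ → ℝ by evaluation. Then the set of points of ℝ at which f has a local maximum and the set of points at which f has a local minimum are both finite, and: if d is odd, the number of local maximum points equals the number of local minimum points; if d is even, the number of local minimum points exceeds the number of local maximum points by exactly 1. Equivalently, (#local maxima of f) − (#local minima of f) equals 0 if d is odd and −1 if d is even. -/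
open Set Filter Topology

/-- A continuous function without zeros on an interval has the same sign at all its points. -/
theorem ContinuousOn.sign_eq_of_forall_ne_zero {g : ℝ → ℝ} {s : Set ℝ} [hs : s.OrdConnected]
    (hg : ContinuousOn g s) (h : ∀ z ∈ s, g z ≠ 0) {x y : ℝ} (hx : x ∈ s) (hy : y ∈ s) :
    SignType.sign (g x) = SignType.sign (g y) := by
  have key : ∀ {u v : ℝ}, u ∈ s → v ∈ s → 0 < g u → 0 < g v := by
    intro u v hu hv hgu
    by_contra! hgv
    obtain ⟨z, hz, hz0⟩ := hs.isPreconnected.intermediate_value hv hu hg ⟨hgv, hgu.le⟩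
    exact h z hz hz0
  rcases (h x hx).lt_or_gt with hgx | hgx
  · have hgy : g y < 0 := (h y hy).lt_of_le (not_lt.1 fun hgy => hgx.not_gt (key hy hx hgy))
    rw [sign_neg hgx, sign_neg hgy]
  · rw [sign_pos hgx, sign_pos (key hx hy hgx)]

theorem StrictMonoOn.not_isLocalMin_right {F : ℝ → ℝ} {x a : ℝ} (hxa : x < a)
    (hF : StrictMonoOn F (Icc x a)) : ¬ IsLocalMin F a := fun h => by
  obtain ⟨z, hz, hzx, hza⟩ := ((h.filter_mono (nhdsWithin_le_nhds (s := Iio a))).and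
    (Ioo_mem_nhdsLT hxa)).exists
  exact hz.not_gt (hF ⟨hzx.le, hza.le⟩ ⟨hxa.le, le_rfl⟩ hza)

theorem StrictMonoOn.not_isLocalMax_left {F : ℝ → ℝ} {a y : ℝ} (hay : a < y)
    (hF : StrictMonoOn F (Icc a y)) : ¬ IsLocalMax F a := fun h => by
  obtain ⟨z, hz, haz, hzy⟩ := ((h.filter_mono (nhdsWithin_le_nhds (s := Ioi a))).and
    (Ioo_mem_nhdsGT hay)).exists
  exact hz.not_gt (hF ⟨le_rfl, hay.le⟩ ⟨haz.le, hzy.le⟩ haz)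

theorem StrictAntiOn.not_isLocalMax_right {F : ℝ → ℝ} {x a : ℝ} (hxa : x < a)
    (hF : StrictAntiOn F (Icc x a)) : ¬ IsLocalMax F a :=
  fun h => hF.neg.not_isLocalMin_right hxa h.neg

theorem StrictAntiOn.not_isLocalMin_left {F : ℝ → ℝ} {a y : ℝ} (hay : a < y)
    (hF : StrictAntiOn F (Icc a y)) : ¬ IsLocalMin F a :=
  fun h => hF.neg.not_isLocalMax_left hay h.neg

open Classical in
/-- The contribution of `a` to the number of local maxima minus the number of local minima. -/
noncomputable def extremumIndex (F : ℝ → ℝ) (a : ℝ) : ℤ :=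
  (if IsLocalMax F a then 1 else 0) - (if IsLocalMin F a then 1 else 0)

/-- The extremum index at an isolated critical point is half the drop of the sign of the
derivative across it. -/
theorem two_mul_extremumIndex {F : ℝ → ℝ} (hF : Differentiable ℝ F) (hF' : Continuous (deriv F))
    {x a y : ℝ} (hxa : x < a) (hay : a < y) (hl : ∀ z ∈ Ico x a, deriv F z ≠ 0)
    (hr : ∀ z ∈ Ioc a y, deriv F z ≠ 0) :
    2 * extremumIndex F a =
      (SignType.sign (deriv F x) : ℤ) - (SignType.sign (deriv F y) : ℤ) := by
  have signl : ∀ z ∈ Ioo x a, SignType.sign (deriv F z) = SignType.sign (deriv F x) :=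
    fun z hz => hF'.continuousOn.sign_eq_of_forall_ne_zero hl ⟨hz.1.le, hz.2⟩ ⟨le_rfl, hxa⟩
  have signr : ∀ z ∈ Ioo a y, SignType.sign (deriv F z) = SignType.sign (deriv F y) :=
    fun z hz => hF'.continuousOn.sign_eq_of_forall_ne_zero hr ⟨hz.1, hz.2.le⟩ ⟨hay, le_rfl⟩
  have hFc := hF.continuous
  rcases (hl x ⟨le_rfl, hxa⟩).lt_or_gt with hx | hx <;>
    rcases (hr y ⟨hay, le_rfl⟩).lt_or_gt with hy | hy
  · simp only [sign_neg hx, sign_eq_neg_one_iff] at signl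
    simp only [sign_neg hy, sign_eq_neg_one_iff] at signr
    have hmax : ¬ IsLocalMax F a := (strictAntiOn_of_deriv_neg (convex_Icc x a) hFc.continuousOn
      (by rwa [interior_Icc])).not_isLocalMax_right hxa
    have hmin : ¬ IsLocalMin F a := (strictAntiOn_of_deriv_neg (convex_Icc a y) hFc.continuousOn
      (by rwa [interior_Icc])).not_isLocalMin_left hay
    simp [extremumIndex, hmax, hmin, hx, hy]
  · simp only [sign_neg hx, sign_eq_neg_one_iff] at signl
    simp only [sign_pos hy, sign_eq_one_iff] at signr
    have hmax : ¬ IsLocalMax F a := (strictAntiOn_of_deriv_neg (convex_Icc x a) hFc.continuousOn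
      (by rwa [interior_Icc])).not_isLocalMax_right hxa
    have hmin : IsLocalMin F a := isLocalMin_of_deriv_Ioo hxa hay hFc.continuousAt
      hF.differentiableOn hF.differentiableOn (fun z hz => (signl z hz).le)
      (fun z hz => (signr z hz).le)
    simp [extremumIndex, hmax, hmin, hx, hy]
  · simp only [sign_pos hx, sign_eq_one_iff] at signl
    simp only [sign_neg hy, sign_eq_neg_one_iff] at signr
    have hmin : ¬ IsLocalMin F a := (strictMonoOn_of_deriv_pos (convex_Icc x a) hFc.continuousOn
      (by rwa [interior_Icc])).not_isLocalMin_right hxa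
    have hmax : IsLocalMax F a := isLocalMax_of_deriv_Ioo hxa hay hFc.continuousAt
      hF.differentiableOn hF.differentiableOn (fun z hz => (signl z hz).le)
      (fun z hz => (signr z hz).le)
    simp [extremumIndex, hmax, hmin, hx, hy]
  · simp only [sign_pos hx, sign_eq_one_iff] at signl
    simp only [sign_pos hy, sign_eq_one_iff] at signr
    have hmin : ¬ IsLocalMin F a := (strictMonoOn_of_deriv_pos (convex_Icc x a) hFc.continuousOn
      (by rwa [interior_Icc])).not_isLocalMin_right hxa
    have hmax : ¬ IsLocalMax F a := (strictMonoOn_of_deriv_pos (convex_Icc a y) hFc.continuousOn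
      (by rwa [interior_Icc])).not_isLocalMax_left hay
    simp [extremumIndex, hmax, hmin, hx, hy]

/-- Summing the extremum indices over the critical points in an interval telescopes to the drop
of the sign of the derivative between its endpoints. -/
theorem two_mul_sum_extremumIndex {F : ℝ → ℝ} (hF : Differentiable ℝ F)
    (hF' : Continuous (deriv F)) {x : ℝ} (S : Finset ℝ) :
    ∀ y, x < y → (∀ z ∈ S, z ∈ Ioo x y) → (∀ z ∈ Icc x y, deriv F z = 0 → z ∈ S) →
      2 * ∑ a ∈ S, extremumIndex F a =
        (SignType.sign (deriv F x) : ℤ) - (SignType.sign (deriv F y) : ℤ) := by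
  induction S using Finset.induction_on_max with
  | empty =>
    intro y hxy _ hS
    have := hF'.continuousOn.sign_eq_of_forall_ne_zero (s := Icc x y)
      (fun z hz h0 => by simpa using hS z hz h0) ⟨le_rfl, hxy.le⟩ ⟨hxy.le, le_rfl⟩
    simp [this]
  | insert a S ha ih =>
    intro y hxy hSI hS
    obtain ⟨hxa, hay⟩ := hSI a (Finset.mem_insert_self a S)
    obtain ⟨b, hb, hba⟩ : ∃ b, (∀ z ∈ insert x S, z < b) ∧ b < a := by
      obtain ⟨b, hb, hba⟩ := exists_between (a₁ := (insert x S).max' (by simp)) (a₂ := a)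
        (by simpa [Finset.max'_lt_iff, hxa] using ha)
      exact ⟨b, fun z hz => ((insert x S).le_max' z hz).trans_lt hb, hba⟩
    have hxb : x < b := hb x (Finset.mem_insert_self x S)
    have hSb : ∀ z ∈ S, z < b := fun z hz => hb z (Finset.mem_insert_of_mem hz)
    have hleft := ih b hxb (fun z hz => ⟨(hSI z (Finset.mem_insert_of_mem hz)).1, hSb z hz⟩)
      (fun z hz h0 => (Finset.mem_insert.1 (hS z ⟨hz.1, by linarith [hz.2]⟩ h0)).resolve_left
        (by linarith [hz.2] : z < a).ne)
    have hright := two_mul_extremumIndex hF hF' hba hay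
      (fun z hz h0 => by
        rcases Finset.mem_insert.1 (hS z ⟨by linarith [hz.1], by linarith [hz.2]⟩ h0) with h | h
        · exact hz.2.ne h
        · exact (hSb z h).not_ge hz.1)
      (fun z hz h0 => by
        rcases Finset.mem_insert.1 (hS z ⟨by linarith [hz.1], hz.2⟩ h0) with h | h
        · exact hz.1.ne' h
        · exact (ha z h).not_gt hz.1)
    rw [Finset.sum_insert fun h => (ha a h).false, mul_add, hleft, hright]
    ring

open Classical in
/-- Over a finite set containing all local extrema, the extremum indices sum to the number of
local maxima minus the number of local minima. -/
theorem sum_extremumIndex {F : ℝ → ℝ} (S : Finset ℝ) (hmax : {x | IsLocalMax F x} ⊆ S)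
    (hmin : {x | IsLocalMin F x} ⊆ S) :
    ∑ a ∈ S, extremumIndex F a =
      ({x | IsLocalMax F x}.ncard : ℤ) - ({x | IsLocalMin F x}.ncard : ℤ) := by
  have card (p : ℝ → Prop) (hp : {x | p x} ⊆ S) : {x | p x}.ncard = (S.filter p).card := by
    rw [← Set.ncard_coe_finset]
    congr 1
    ext x
    simpa using fun h => hp h
  rw [card _ hmax, card _ hmin]
  simp [extremumIndex, Finset.sum_sub_distrib]

/-- The real realization of the enriched Riemann–Hurwitz formula: for a monic real
polynomial `f` of degree `d ≥ 1`, the sets of local maximum points and local minimum points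
of `f : ℝ → ℝ` are finite, and `#max = #min` when `d` is odd while `#min = #max + 1` when
`d` is even (i.e. `#max − #min` is `0` for `d` odd and `−1` for `d` even). -/
theorem monic_polynomial_local_max_min_count (f : Polynomial ℝ) (hf : f.Monic)
    (hd : 1 ≤ f.natDegree) :
    {x : ℝ | IsLocalMax (fun y => f.eval y) x}.Finite ∧
    {x : ℝ | IsLocalMin (fun y => f.eval y) x}.Finite ∧
    (if Odd f.natDegree then
      {x : ℝ | IsLocalMax (fun y => f.eval y) x}.ncard =
        {x : ℝ | IsLocalMin (fun y => f.eval y) x}.ncard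
    else
      {x : ℝ | IsLocalMin (fun y => f.eval y) x}.ncard =
        {x : ℝ | IsLocalMax (fun y => f.eval y) x}.ncard + 1) := by
  have hderiv : deriv (fun y => f.eval y) = fun y => f.derivative.eval y := by
    ext y
    exact f.deriv
  have hne : f.derivative ≠ 0 := Polynomial.derivative_ne_zero.2 (by lia)
  set S := f.derivative.roots.toFinset with hSdef
  have hS : ∀ z, z ∈ S ↔ f.derivative.eval z = 0 := fun z => by simp [hSdef, hne]
  have hmax : {x : ℝ | IsLocalMax (fun y => f.eval y) x} ⊆ S := fun x hx =>
    (hS x).2 (f.deriv ▸ IsLocalMax.deriv_eq_zero hx)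
  have hmin : {x : ℝ | IsLocalMin (fun y => f.eval y) x} ⊆ S := fun x hx =>
    (hS x).2 (f.deriv ▸ IsLocalMin.deriv_eq_zero hx)
  refine ⟨S.finite_toSet.subset hmax, S.finite_toSet.subset hmin, ?_⟩
  obtain ⟨u, hu⟩ := S.bddAbove
  obtain ⟨l, hl⟩ := S.bddBelow
  obtain ⟨y, hy⟩ := exists_gt (max u l)
  obtain ⟨x, hx⟩ := exists_lt (min u l)
  rw [max_lt_iff] at hy
  rw [lt_min_iff] at hx
  have hxS : ∀ z ∈ S, x < z := fun z hz => hx.2.trans_le (hl hz)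
  have hSy : ∀ z ∈ S, z < y := fun z hz => (hu hz).trans_lt hy.1
  have hlead : 0 ≤ f.derivative.leadingCoeff := by simp [hf.leadingCoeff]
  have hpos := Polynomial.zero_lt_eval_of_roots_lt_of_leadingCoeff_nonneg
    (fun z hz => hSy z ((hS z).2 hz)) hlead
  have hneg := Polynomial.zero_lt_negOnePow_mul_eval_of_lt_roots_of_leadingCoeff_nonneg
    (fun z hz => hxS z ((hS z).2 hz)) hlead
  have htele := two_mul_sum_extremumIndex (F := fun y => f.eval y) (x := x) f.differentiable
    (hderiv ▸ f.derivative.continuous) S y (by linarith) (fun z hz => ⟨hxS z hz, hSy z hz⟩)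
    (fun z _ hz => (hS z).2 (f.deriv ▸ hz))
  rw [sum_extremumIndex S hmax hmin, hderiv, sign_pos hpos] at htele
  rw [Polynomial.natDegree_derivative] at hneg
  split_ifs with hodd
  · have heven : Even ((f.natDegree - 1 : ℕ) : ℤ) := by
      rw [Int.even_coe_nat]
      exact Nat.Odd.sub_odd hodd odd_one
    rw [Int.negOnePow_even _ heven] at hneg
    rw [sign_pos (by simpa using hneg)] at htele
    simp only [SignType.coe_one] at htele
    lia
  · have hodd' : Odd ((f.natDegree - 1 : ℕ) : ℤ) := by
      rw [Int.odd_coe_nat]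
      exact Nat.Even.sub_odd hd (Nat.not_odd_iff_even.1 hodd) odd_one
    rw [Int.negOnePow_odd _ hodd'] at hneg
    rw [sign_neg (by simpa using hneg)] at htele
    simp only [SignType.coe_one, SignType.coe_neg_one] at htele
    lia
end
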